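/- Let k be a field and let x₁, …, x₅ be five pairwise distinct points of ℙ¹(k). Then Σ_{i=1}^{5} (−1)^i · ⟨1 − rᵢ⟩ ∧ ⟨rᵢ⟩ = 0 in Λ²(kˣ_ℚ), where rᵢ = r(x₁, …, x̂ᵢ, …, x₅) is the cross-ratio of the four points obtained by omitting xᵢ (for four distinct points this cross-ratio lies in k ∖ {0,1}). That is, the differential δ₂ : {x} ↦ (1−x) ∧ x annihilates the five-term relation elements, so that it descends to the Bloch group. -/

import Mathlib

open scoped TensorProduct

open Classical in
/-- The class `⟨x⟩` of a nonzero field element `x` in the `ℚ`-vector space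
`kˣ_ℚ = ℚ ⊗_ℤ kˣ` (with junk value `0` for `x = 0`). -/
noncomputable def cl {k : Type*} [Field k] (x : k) : ℚ ⊗[ℤ] Additive kˣ :=
  if h : x = 0 then 0 else (1 : ℚ) ⊗ₜ[ℤ] Additive.ofMul (Units.mk0 x h)

/-- The wedge `⟨x⟩ ∧ ⟨y⟩` in `Λ²_ℚ(kˣ_ℚ)`, realized inside the exterior algebra over `ℚ`
of the `ℚ`-vector space `kˣ_ℚ = ℚ ⊗_ℤ kˣ`. -/
noncomputable def wdg {k : Type*} [Field k] (x y : k) :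
    ExteriorAlgebra ℚ (ℚ ⊗[ℤ] Additive kˣ) :=
  ExteriorAlgebra.ι ℚ (cl x) * ExteriorAlgebra.ι ℚ (cl y)

/-- Difference of two points of `ℙ¹(k) = k ∪ {∞}` (with `∞ = none`), with the convention
that any difference involving `∞` is `1`, so that `∞`-terms cancel in the cross-ratio. -/
def dd {k : Type*} [Field k] : Option k → Option k → k
  | some a, some b => a - b
  | _, _ => 1

/-- The cross-ratio `r(x₁,x₂,x₃,x₄) = ((x₁-x₃)(x₂-x₄))/((x₁-x₄)(x₂-x₃))` of four points
of `ℙ¹(k)`, normalized so that `r(∞,0,1,x) = x`, with the usual conventions at `∞`. -/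
def crossRatio {k : Type*} [Field k] (x1 x2 x3 x4 : Option k) : k :=
  (dd x1 x3 * dd x2 x4) / (dd x1 x4 * dd x2 x3)

theorem cl_mul {k : Type*} [Field k] {x y : k} (hx : x ≠ 0) (hy : y ≠ 0) :
    cl (x * y) = cl x + cl y := by
  have h : Units.mk0 (x * y) (mul_ne_zero hx hy) = Units.mk0 x hx * Units.mk0 y hy := by
    ext; rfl
  simp only [cl, hx, hy, mul_ne_zero hx hy, dite_false, h, ofMul_mul, TensorProduct.tmul_add]

@[simp]
theorem cl_one {k : Type*} [Field k] : cl (1 : k) = 0 := by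
  simpa using cl_mul (one_ne_zero (α := k)) one_ne_zero

theorem cl_div {k : Type*} [Field k] {x y : k} (hx : x ≠ 0) (hy : y ≠ 0) :
    cl (x / y) = cl x - cl y := by
  rw [eq_sub_iff_add_eq, ← cl_mul (div_ne_zero hx hy) hy, div_mul_cancel₀ _ hy]

theorem cl_neg_one {k : Type*} [Field k] : cl (-1 : k) = 0 := by
  have h := cl_mul (k := k) (neg_ne_zero.2 one_ne_zero) (neg_ne_zero.2 one_ne_zero)
  rw [neg_mul_neg, one_mul, cl_one, ← two_smul ℚ] at h
  exact (smul_eq_zero.1 h.symm).resolve_left two_ne_zero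

theorem cl_neg {k : Type*} [Field k] {x : k} (hx : x ≠ 0) : cl (-x) = cl x := by
  rw [← neg_one_mul, cl_mul (neg_ne_zero.2 one_ne_zero) hx, cl_neg_one, zero_add]

theorem dd_ne_zero {k : Type*} [Field k] {x y : Option k} (h : x ≠ y) : dd x y ≠ 0 := by
  cases x <;> cases y <;> simp_all [dd, sub_eq_zero]

/-- The Plücker relation, up to sign, in the form it takes for points of `ℙ¹(k)`. -/
theorem one_sub_crossRatio {k : Type*} [Field k] {x y z w : Option k} (hxy : x ≠ y)
    (hxz : x ≠ z) (hxw : x ≠ w) (hyz : y ≠ z) (hyw : y ≠ w) (hzw : z ≠ w) :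
    1 - crossRatio x y z w = dd x y * dd z w / (dd x w * dd y z) ∨
      1 - crossRatio x y z w = -(dd x y * dd z w / (dd x w * dd y z)) := by
  have h₁ := dd_ne_zero hxw
  have h₂ := dd_ne_zero hyz
  rw [← neg_div, crossRatio, one_sub_div (mul_ne_zero h₁ h₂), div_left_inj' (mul_ne_zero h₁ h₂),
    div_left_inj' (mul_ne_zero h₁ h₂)]
  rcases x with _ | x <;> rcases y with _ | y <;> rcases z with _ | z <;> rcases w with _ | w <;>
    first
    | contradiction
    | (left; simp only [dd]; ring1)
    | (right; simp only [dd]; ring1)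

theorem cl_crossRatio {k : Type*} [Field k] {x y z w : Option k}
    (hxz : x ≠ z) (hxw : x ≠ w) (hyz : y ≠ z) (hyw : y ≠ w) :
    cl (crossRatio x y z w) =
      cl (dd x z) + cl (dd y w) - (cl (dd x w) + cl (dd y z)) := by
  have := dd_ne_zero hxz
  have := dd_ne_zero hxw
  have := dd_ne_zero hyz
  have := dd_ne_zero hyw
  rw [crossRatio, cl_div, cl_mul, cl_mul] <;> simp [*]

theorem cl_one_sub_crossRatio {k : Type*} [Field k] {x y z w : Option k} (hxy : x ≠ y)
    (hxz : x ≠ z) (hxw : x ≠ w) (hyz : y ≠ z) (hyw : y ≠ w) (hzw : z ≠ w) :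
    cl (1 - crossRatio x y z w) =
      cl (dd x y) + cl (dd z w) - (cl (dd x w) + cl (dd y z)) := by
  have := dd_ne_zero hxy
  have := dd_ne_zero hxw
  have := dd_ne_zero hyz
  have := dd_ne_zero hzw
  have h : cl (1 - crossRatio x y z w) = cl (dd x y * dd z w / (dd x w * dd y z)) := by
    rcases one_sub_crossRatio hxy hxz hxw hyz hyw hzw with h | h
    · rw [h]
    · rw [h, cl_neg]
      simp [*]
  rw [h, cl_div, cl_mul, cl_mul] <;> simp [*]

theorem wdg_crossRatio {k : Type*} [Field k] {x y z w : Option k} (hxy : x ≠ y)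
    (hxz : x ≠ z) (hxw : x ≠ w) (hyz : y ≠ z) (hyw : y ≠ w) (hzw : z ≠ w) :
    wdg (1 - crossRatio x y z w) (crossRatio x y z w) =
      ExteriorAlgebra.ι ℚ (cl (dd x y) + cl (dd z w) - (cl (dd x w) + cl (dd y z))) *
        ExteriorAlgebra.ι ℚ (cl (dd x z) + cl (dd y w) - (cl (dd x w) + cl (dd y z))) := by
  rw [wdg, cl_one_sub_crossRatio hxy hxz hxw hyz hyw hzw, cl_crossRatio hxz hxw hyz hyw]

/-- The five-term relation for the wedge, with formal symbols `aᵢⱼ` in place of `⟨xᵢ - xⱼ⟩`. -/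
theorem five_term_exteriorAlgebra {V : Type*} [AddCommGroup V] [Module ℚ V]
    (a01 a02 a03 a04 a12 a13 a14 a23 a24 a34 : V) :
    ExteriorAlgebra.ι ℚ (a12 + a34 - (a14 + a23)) *
        ExteriorAlgebra.ι ℚ (a13 + a24 - (a14 + a23))
      - ExteriorAlgebra.ι ℚ (a02 + a34 - (a04 + a23)) *
        ExteriorAlgebra.ι ℚ (a03 + a24 - (a04 + a23))
      + ExteriorAlgebra.ι ℚ (a01 + a34 - (a04 + a13)) *
        ExteriorAlgebra.ι ℚ (a03 + a14 - (a04 + a13))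
      - ExteriorAlgebra.ι ℚ (a01 + a24 - (a04 + a12)) *
        ExteriorAlgebra.ι ℚ (a02 + a14 - (a04 + a12))
      + ExteriorAlgebra.ι ℚ (a01 + a23 - (a03 + a12)) *
        ExteriorAlgebra.ι ℚ (a02 + a13 - (a03 + a12)) = 0 := by
  have swap (u v : V) : ExteriorAlgebra.ι ℚ u * ExteriorAlgebra.ι ℚ v =
      -(ExteriorAlgebra.ι ℚ v * ExteriorAlgebra.ι ℚ u) :=
    eq_neg_of_add_eq_zero_left (ExteriorAlgebra.ι_add_mul_swap u v)
  simp only [map_add, map_sub, mul_add, add_mul, mul_sub, sub_mul, ExteriorAlgebra.ι_sq_zero]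
  simp only [swap a03 a02, swap a04 a02, swap a12 a02, swap a23 a02, swap a24 a02, swap a04 a03,
    swap a12 a03, swap a13 a03, swap a23 a03, swap a34 a03, swap a12 a04, swap a13 a04,
    swap a23 a04, swap a24 a04, swap a34 a04, swap a23 a12, swap a24 a12, swap a14 a13,
    swap a23 a13, swap a34 a13, swap a23 a14, swap a24 a14, swap a34 a14, swap a34 a23]
  abel

/-- For five pairwise distinct points `x₁, …, x₅` of `ℙ¹(k)`,
`Σᵢ (-1)ⁱ ⟨1 - rᵢ⟩ ∧ ⟨rᵢ⟩ = 0` in `Λ²(kˣ_ℚ)`, where `rᵢ` is the cross-ratio of the four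
points obtained by omitting `xᵢ`: the differential `δ₂ : {x} ↦ (1-x) ∧ x` annihilates the
five-term relation elements. -/
theorem stmt_4 {k : Type*} [Field k] (x : Fin 5 → Option k) (hx : Function.Injective x) :
    ∑ i : Fin 5, ((-1 : ℚ) ^ (i : ℕ)) •
      wdg (1 - crossRatio (x (i.succAbove 0)) (x (i.succAbove 1))
              (x (i.succAbove 2)) (x (i.succAbove 3)))
          (crossRatio (x (i.succAbove 0)) (x (i.succAbove 1))
              (x (i.succAbove 2)) (x (i.succAbove 3))) = 0 := by
  have h (i : Fin 5) := wdg_crossRatio (x := x (i.succAbove 0)) (y := x (i.succAbove 1))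
    (z := x (i.succAbove 2)) (w := x (i.succAbove 3))
    (by simp [hx.eq_iff]) (by simp [hx.eq_iff]) (by simp [hx.eq_iff])
    (by simp [hx.eq_iff]) (by simp [hx.eq_iff]) (by simp [hx.eq_iff])
  simp only [h]
  rw [← five_term_exteriorAlgebra (cl (dd (x 0) (x 1))) (cl (dd (x 0) (x 2)))
    (cl (dd (x 0) (x 3))) (cl (dd (x 0) (x 4))) (cl (dd (x 1) (x 2))) (cl (dd (x 1) (x 3)))
    (cl (dd (x 1) (x 4))) (cl (dd (x 2) (x 3))) (cl (dd (x 2) (x 4))) (cl (dd (x 3) (x 4)))]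
  have pow_even : ((-1 : ℚ) ^ ((0 : Fin 5) : ℕ)) = 1 ∧ ((-1 : ℚ) ^ ((2 : Fin 5) : ℕ)) = 1 ∧
      ((-1 : ℚ) ^ ((4 : Fin 5) : ℕ)) = 1 := by norm_num [Fin.val_ofNat]
  have pow_odd : ((-1 : ℚ) ^ ((1 : Fin 5) : ℕ)) = -1 ∧
      ((-1 : ℚ) ^ ((3 : Fin 5) : ℕ)) = -1 := by norm_num [Fin.val_ofNat]
  rw [Fin.sum_univ_five, pow_even.1, pow_even.2.1, pow_even.2.2, pow_odd.1, pow_odd.2]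
  simp only [one_smul, neg_smul, ← sub_eq_add_neg]
  rfl
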